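/- Let H be a nontrivial separable complex Hilbert space, γ > 0, C > 0, and w : ℤ × ℤ → B(H) with ‖w(n,m)‖ ≤ C·e^{−γ(|n|+|m|)} for all (n,m) ∈ ℤ². Let Λ₁ ∈ B(H), let Λ₂ ∈ B(H) be compact with the range of Λ₂ ∘ Λ₁ finite-dimensional, let V be the bounded operator on ℓ²(ℤ,H) defined by (Vφ)(n) = ∑_{m∈ℤ} Λ₁(w(n,m)(Λ₂(φ(m)))), and set H_V := H₀ + V. Then there exists r > 0 such that H_V has no eigenvalues in the punctured disks around the spectral thresholds 0 and 4: for every z ∈ ℂ with 0 < |z| < r or 0 < |z − 4| < r, and every φ ∈ ℓ²(ℤ,H) with H_Vφ = zφ, one has φ = 0. -/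

import Mathlib

open Filter Topology

lemma fredholm_like {E F ι : Type*} [NormedAddCommGroup E] [NormedSpace ℂ E] [CompleteSpace E]
    [NormedAddCommGroup F] [NormedSpace ℂ F] [FiniteDimensional ℂ F]
    (U : Set ℂ) (hU : IsOpen U) (hc : IsPreconnected U)
    (a : ι → E →L[ℂ] F) (J : ι → ℂ → F →L[ℂ] E)
    (hJ : ∀ i, DifferentiableOn ℂ (J i) U) (u : ι → ℝ) (hu : Summable u)
    (hb : ∀ i, ∀ t ∈ U, ‖J i t‖ * ‖a i‖ ≤ u i)
    (t0 : ℂ) (ht0 : t0 ∈ U) (h0 : ∀ x, x + ∑' i, J i t0 (a i x) = 0 → x = 0)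
    (t1 : ℂ) (ht1 : t1 ∈ U) :
    ∀ᶠ t in 𝓝[≠] t1, ∀ x, x + ∑' i, J i t (a i x) = 0 → x = 0 := by
  classical
  have hcb : ∀ i, ∀ t ∈ U, ‖J i t ∘L a i‖ ≤ u i := fun i t ht =>
    (ContinuousLinearMap.opNorm_comp_le _ _).trans (hb i t ht)
  have hsumm : ∀ t ∈ U, Summable (fun i => J i t ∘L a i) := fun t ht =>
    Summable.of_norm_bounded hu (fun i => hcb i t ht)
  obtain ⟨s, hs⟩ : ∃ s : Finset ι, ∑' i : {x // x ∉ s}, u i < 1 :=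
    ((tendsto_tsum_compl_atTop_zero u).eventually (gt_mem_nhds one_pos)).exists
  have hus : Summable (fun i : {x // x ∉ s} => u i) := hu.subtype _
  let R : ℂ → E →L[ℂ] E := fun t => ∑' i : {x // x ∉ s}, J i t ∘L a i
  have hRd : DifferentiableOn ℂ R U := by
    apply Complex.differentiableOn_tsum_of_summable_norm hus
    · intro i
      exact fun t ht => (hJ i t ht).clm_comp (differentiableWithinAt_const _)
    · exact hU
    · intro i t ht
      exact hcb i t ht
  have hRn : ∀ t ∈ U, ‖R t‖ < 1 := fun t ht =>
    (tsum_of_norm_bounded hus.hasSum (fun i => hcb i t ht)).trans_lt hs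
  let S : ℂ → E →L[ℂ] E := fun t => 1 + R t
  have hSu : ∀ t ∈ U, IsUnit (S t) := fun t ht => by
    have := isUnit_one_sub_of_norm_lt_one (x := - R t) (by simpa using hRn t ht)
    simpa [S] using this
  let Si : ℂ → E →L[ℂ] E := fun t => Ring.inverse (S t)
  have hSid : DifferentiableOn ℂ Si U := by
    intro t ht
    have h1 : DifferentiableWithinAt ℂ S U t := (hRd t ht).const_add _
    obtain ⟨v, hv⟩ := hSu t ht
    have h2 : DifferentiableAt ℂ Ring.inverse (S t) := by
      rw [← hv]; exact differentiableAt_inverse v.isUnit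
    exact h2.comp_differentiableWithinAt t h1
  let Q : E →L[ℂ] (s → F) := ContinuousLinearMap.pi fun i => a i
  let P : ℂ → (s → F) →L[ℂ] E := fun t =>
    ∑ i : s, J i t ∘L (ContinuousLinearMap.proj (R := ℂ) (φ := fun _ : s => F) i)
  have hPd : DifferentiableOn ℂ P U := by
    apply DifferentiableOn.fun_sum
    intro i _
    exact fun t ht => (hJ i t ht).clm_comp (differentiableWithinAt_const _)
  have hdec : ∀ t ∈ U, ∀ x, x + ∑' i, J i t (a i x) = S t x + P t (Q x) := by
    intro t ht x
    have h1 : ∑' i, J i t (a i x) = (∑' i, J i t ∘L a i) x := by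
      have := (ContinuousLinearMap.apply ℂ E x).map_tsum (hsumm t ht)
      simpa using this.symm
    have h2 := (hsumm t ht).sum_add_tsum_subtype_compl s
    rw [h1, ← h2]
    have h3 : (∑ i ∈ s, J i t ∘L a i) x = P t (Q x) := by
      simp only [P, Q, sum_apply, ContinuousLinearMap.comp_apply]
      rw [← Finset.sum_coe_sort]
      rfl
    rw [add_apply, h3]
    simp only [S, R, add_apply, one_apply_eq_self]
    abel
  have hSS : ∀ t ∈ U, ∀ x, S t (Si t x) = x := fun t ht x => by
    have := Ring.mul_inverse_cancel _ (hSu t ht)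
    exact congrArg (fun A : E →L[ℂ] E => A x) this
  have hSS' : ∀ t ∈ U, ∀ x, Si t (S t x) = x := fun t ht x => by
    have := Ring.inverse_mul_cancel _ (hSu t ht)
    exact congrArg (fun A : E →L[ℂ] E => A x) this
  let M : ℂ → (s → F) →L[ℂ] (s → F) := fun t => 1 + Q ∘L Si t ∘L P t
  have hMd : DifferentiableOn ℂ M U := by
    intro t ht
    exact ((differentiableWithinAt_const Q).clm_comp
      ((hSid t ht).clm_comp (hPd t ht))).const_add _
  let b := Module.finBasis ℂ (s → F)
  let D : ℂ → ℂ := fun t => LinearMap.det (M t : (s → F) →ₗ[ℂ] (s → F))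
  have hDd : DifferentiableOn ℂ D U := by
    have : D = fun t => (LinearMap.toMatrix b b (M t : (s → F) →ₗ[ℂ] (s → F))).det := by
      funext t; simp [D]
    rw [this]
    simp only [Matrix.det_apply]
    apply DifferentiableOn.fun_sum
    intro σ _
    apply DifferentiableOn.const_smul
    apply DifferentiableOn.fun_finsetProd
    intro i _
    simp only [LinearMap.toMatrix_apply]
    let L : (s → F) →L[ℂ] ℂ := LinearMap.toContinuousLinearMap (b.coord (σ i))
    intro t ht
    exact L.differentiableAt.comp_differentiableWithinAt t
      ((hMd t ht).clm_apply (differentiableWithinAt_const (b i)))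
  have hD0 : D t0 ≠ 0 := by
    intro h
    refine LinearMap.det_eq_zero_iff_ker_ne_bot.1 h (LinearMap.ker_eq_bot'.2 fun c hc => ?_)
    have hc' : c + Q (Si t0 (P t0 c)) = 0 := hc
    have hQc : Q (-(Si t0 (P t0 c))) = c := by
      rw [map_neg]; exact (eq_neg_of_add_eq_zero_left hc').symm
    have := h0 (-(Si t0 (P t0 c))) (by
      rw [hdec t0 ht0, hQc, map_neg, hSS t0 ht0]; simp)
    rw [← hQc, this, map_zero]
  have han : AnalyticOnNhd ℂ D U := hDd.analyticOnNhd hU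
  have hev : ∀ᶠ t in 𝓝[≠] t1, D t ≠ 0 := by
    rcases (han t1 ht1).eventually_eq_zero_or_eventually_ne_zero with h | h
    · exact absurd (han.eqOn_zero_of_preconnected_of_eventuallyEq_zero hc ht1 h ht0) hD0
    · exact h
  filter_upwards [hev, nhdsWithin_le_nhds (hU.mem_nhds ht1)] with t hDt ht x hx
  rw [hdec t ht] at hx
  have hx1 : x + Si t (P t (Q x)) = 0 := by
    have := congrArg (Si t) hx
    rwa [map_add, hSS' t ht, map_zero] at this
  have hMQ : (M t : (s → F) →ₗ[ℂ] (s → F)) (Q x) = 0 := by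
    have := congrArg Q hx1
    rw [map_add, map_zero] at this
    exact this
  have hQ : Q x = 0 := by
    have hk : LinearMap.ker (M t : (s → F) →ₗ[ℂ] (s → F)) = ⊥ := by
      by_contra hne
      exact hDt (LinearMap.det_eq_zero_iff_ker_ne_bot.2 hne)
    exact LinearMap.ker_eq_bot'.1 hk _ hMQ
  rw [hQ] at hx1
  simpa using hx1

lemma green {H : Type*} [NormedAddCommGroup H] [NormedSpace ℂ H] [CompleteSpace H]
    (t : ℂ) (ht0 : t ≠ 0) (ht : ‖t‖ ≤ 1) (φ : ℤ → H) (hφ : Tendsto φ cofinite (𝓝 0))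
    (h : ℤ → H) (hh : ∀ m, h m = (t + t⁻¹) • φ m - φ (m + 1) - φ (m - 1))
    (hs : Summable fun m => ‖h m‖) (n : ℤ) :
    HasSum (fun m => t ^ (n - m).natAbs • h m) ((t⁻¹ - t) • φ n) := by
  have aux : ∀ (φ : ℤ → H), Tendsto φ cofinite (𝓝 0) → ∀ (h : ℤ → H), (∀ m, h m = (t + t⁻¹) • φ m - φ (m + 1) - φ (m - 1)) → (Summable fun m => ‖h m‖) → 
      HasSum (fun k : ℕ => t ^ k • h k) (t⁻¹ • φ 0 - φ (-1)) := by
    intro φ hφ h hh hs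
    have hsn : Summable fun k : ℕ => ‖h k‖ := hs.comp_injective Nat.cast_injective
    have hsn' : Summable (fun k : ℕ => t ^ k • h k) := by
      refine Summable.of_norm_bounded hsn fun k => ?_
      rw [norm_smul, norm_pow]
      exact mul_le_of_le_one_left (norm_nonneg _) (pow_le_one₀ (norm_nonneg _) ht)
    rw [hsn'.hasSum_iff_tendsto_nat]
    have hsum : ∀ N : ℕ, ∑ k ∈ Finset.range N, t ^ k • h k =
        (t ^ N • φ ((N : ℤ) - 1) - (t⁻¹ * t ^ N) • φ N) + (t⁻¹ • φ 0 - φ (-1)) := by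
      intro N
      induction N with
      | zero => simp
      | succ N ih =>
        rw [Finset.sum_range_succ, ih, hh]
        push_cast
        simp only [add_sub_cancel_right, smul_sub, smul_smul]
        have e1 : t ^ N * (t + t⁻¹) = t ^ (N + 1) + t⁻¹ * t ^ N := by ring
        have e2 : t⁻¹ * t ^ (N + 1) = t ^ N := by rw [pow_succ', inv_mul_cancel_left₀ ht0]
        rw [e1, e2, add_smul]
        abel
    have hz : Tendsto (fun N : ℕ => t ^ N • φ ((N : ℤ) - 1) - (t⁻¹ * t ^ N) • φ N) atTop (𝓝 0) := by
      have inj1 : Function.Injective (fun N : ℕ => (N : ℤ) - 1) := fun a b h => by simpa using h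
      have t1 : Tendsto (fun N : ℕ => φ ((N : ℤ) - 1)) atTop (𝓝 0) := by
        rw [← Nat.cofinite_eq_atTop]; exact hφ.comp inj1.tendsto_cofinite
      have t2 : Tendsto (fun N : ℕ => φ (N : ℤ)) atTop (𝓝 0) := by
        rw [← Nat.cofinite_eq_atTop]; exact hφ.comp (Nat.cast_injective.tendsto_cofinite)
      have key : ∀ g : ℕ → H, Tendsto g atTop (𝓝 0) →
          Tendsto (fun N => t ^ N • g N) atTop (𝓝 0) := by
        intro g hg
        refine squeeze_zero_norm (fun N => ?_) (tendsto_zero_iff_norm_tendsto_zero.1 hg)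
        rw [norm_smul, norm_pow]
        exact mul_le_of_le_one_left (norm_nonneg _) (pow_le_one₀ (norm_nonneg _) ht)
      have := (key _ t1).sub ((key _ t2).const_smul t⁻¹)
      simpa [smul_smul] using this
    simp only [hsum]
    simpa using hz.add_const (t⁻¹ • φ 0 - φ (-1))
  have hp := aux (fun k => φ (n + k)) (hφ.comp (add_right_injective n).tendsto_cofinite)
    (fun k => h (n + k)) (fun m => by simp only [hh, add_assoc, add_sub_assoc])
    (hs.comp_injective (add_right_injective n))
  have inj2 : Function.Injective (fun k : ℤ => n - 1 - k) := fun a b h => by simpa using h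
  have hm := aux (fun k => φ (n - 1 - k)) (hφ.comp inj2.tendsto_cofinite)
    (fun k => h (n - 1 - k)) (fun m => by
      simp only [hh]
      rw [show n - 1 - (m + 1) = n - 1 - m - 1 by ring, show n - 1 - (m - 1) = n - 1 - m + 1 by ring]
      abel)
    (hs.comp_injective inj2)
  have hm' := hm.const_smul t
  have tot : HasSum (fun k : ℤ => t ^ k.natAbs • h (n + k)) ((t⁻¹ - t) • φ n) := by
    have := HasSum.of_nat_of_neg_add_one (f := fun k : ℤ => t ^ k.natAbs • h (n + k))
      (m := t⁻¹ • φ n - φ (n - 1)) (m' := φ (n-1) - t • φ n) (by simpa [sub_eq_add_neg] using hp) ?_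
    · convert this using 1
      rw [sub_smul]; abel
    · convert hm' using 1
      · funext k
        have e1 : (-((k : ℤ) + 1)).natAbs = k + 1 := by omega
        rw [e1, smul_smul, pow_succ', show n + -((k : ℤ) + 1) = n - 1 - k by ring]
      · rw [smul_sub, smul_smul, mul_inv_cancel₀ ht0]; simp
  rw [← (Equiv.addLeft n).hasSum_iff]
  convert tot using 1
  funext k
  simp

lemma summable_exp_abs (δ : ℝ) (hδ : 0 < δ) :
    Summable fun n : ℤ => Real.exp (-δ * |(n : ℝ)|) := by
  have h : Summable fun n : ℕ => Real.exp (-δ * n) := by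
    have := summable_geometric_of_lt_one (Real.exp_pos (-δ)).le (by simpa using hδ)
    refine this.congr fun n => ?_
    rw [← Real.exp_nat_mul, mul_comm]
  apply Summable.of_nat_of_neg <;> simpa using h

noncomputable def Kop {H F : Type*} [NormedAddCommGroup H] [NormedSpace ℂ H]
    [NormedAddCommGroup F] [NormedSpace ℂ F] (j : F →L[ℂ] H) (g : ℤ → ℂ) :
    F →L[ℂ] lp (fun _ : ℤ => H) ⊤ :=
  ∑' n, g n • (lp.singleContinuousLinearMap ℂ (fun _ : ℤ => H) ⊤ n ∘L j)

section Kop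
variable {H F : Type*} [NormedAddCommGroup H] [NormedSpace ℂ H] [CompleteSpace H]
    [NormedAddCommGroup F] [NormedSpace ℂ F] (j : F →L[ℂ] H)

lemma single_comp_norm (n : ℤ) :
    ‖(lp.singleContinuousLinearMap ℂ (fun _ : ℤ => H) ⊤ n ∘L j)‖ ≤ ‖j‖ := by
  refine ContinuousLinearMap.opNorm_le_bound _ (norm_nonneg _) fun x => ?_
  rw [ContinuousLinearMap.comp_apply, lp.singleContinuousLinearMap_apply,
    lp.norm_single (by simp)]
  exact j.le_opNorm x

lemma term_norm (g : ℤ → ℂ) (u : ℤ → ℝ) (hg : ∀ n, ‖g n‖ ≤ u n) (n : ℤ) :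
    ‖g n • (lp.singleContinuousLinearMap ℂ (fun _ : ℤ => H) ⊤ n ∘L j)‖ ≤ u n * ‖j‖ := by
  rw [norm_smul]
  exact mul_le_mul (hg n) (single_comp_norm j n) (norm_nonneg _) ((norm_nonneg _).trans (hg n))

lemma Kop_summable (g : ℤ → ℂ) (u : ℤ → ℝ) (hu : Summable u) (hg : ∀ n, ‖g n‖ ≤ u n) :
    Summable fun n => g n • (lp.singleContinuousLinearMap ℂ (fun _ : ℤ => H) ⊤ n ∘L j) :=
  Summable.of_norm_bounded (hu.mul_right _) (term_norm j g u hg)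

lemma Kop_norm (g : ℤ → ℂ) (u : ℤ → ℝ) (hu : Summable u) (hg : ∀ n, ‖g n‖ ≤ u n) :
    ‖Kop j g‖ ≤ (∑' n, u n) * ‖j‖ :=
  tsum_of_norm_bounded (hu.hasSum.mul_right _) (term_norm j g u hg)

lemma Kop_apply (g : ℤ → ℂ) (u : ℤ → ℝ) (hu : Summable u) (hg : ∀ n, ‖g n‖ ≤ u n)
    (f : F) (n : ℤ) : (Kop j g f) n = g n • j f := by
  have h1 := (Kop_summable j g u hu hg).hasSum.mapL
    (lp.evalCLM ℂ (fun _ : ℤ => H) (p := ⊤) n ∘L ContinuousLinearMap.apply ℂ _ f)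
  have h2 : HasSum (fun k : ℤ => if k = n then g n • j f else 0) (g n • j f) :=
    hasSum_ite_eq n _
  refine h1.unique ?_
  convert h2 using 1
  funext k
  simp only [lp.evalCLM, ContinuousLinearMap.comp_apply]
  by_cases hk : k = n
  · subst hk; simp
  · simp [hk, Ne.symm hk, lp.single_apply]

lemma Kop_diff (U : Set ℂ) (hU : IsOpen U) (g : ℤ → ℂ → ℂ) (u : ℤ → ℝ) (hu : Summable u)
    (hg : ∀ n, ∀ t ∈ U, ‖g n t‖ ≤ u n) (hd : ∀ n, DifferentiableOn ℂ (g n) U) :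
    DifferentiableOn ℂ (fun t => Kop j (fun n => g n t)) U := by
  apply Complex.differentiableOn_tsum_of_summable_norm (hu.mul_right ‖j‖)
  · intro n t ht
    exact (hd n t ht).smul_const _
  · exact hU
  · intro n t ht
    exact term_norm j (fun n => g n t) u (fun n => hg n t ht) n
end Kop

noncomputable def bk (k : ℕ) (t : ℂ) : ℂ := -(t / (1 + t)) * ∑ i ∈ Finset.range k, t ^ i

lemma bk_eq (k : ℕ) (t : ℂ) (h1 : 1 - t ≠ 0) (h2 : 1 + t ≠ 0) :
    (t⁻¹ - t) * bk k t = t ^ k - 1 ∨ t = 0 := by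
  by_cases h0 : t = 0
  · exact Or.inr h0
  left
  have h3 : t - 1 ≠ 0 := fun h => h1 (by rw [← neg_sub, h, neg_zero])
  rw [bk, geom_sum_eq (fun h => h1 (by rw [h, sub_self]))]
  field_simp
  ring

lemma bk_bound (δ : ℝ) (hδ : 0 < δ) (k : ℕ) (t : ℂ) (ht : ‖t‖ ≤ Real.exp (δ / 4))
    (ht' : 1 / 2 ≤ ‖1 + t‖) :
    ‖bk k t‖ ≤ (2 * Real.exp (δ / 4) * (4 / δ)) * Real.exp (δ / 2 * k) := by
  have hsum : ‖∑ i ∈ Finset.range k, t ^ i‖ ≤ k * Real.exp (δ / 4 * k) := by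
    refine (norm_sum_le _ _).trans ?_
    have : ∀ i ∈ Finset.range k, ‖t ^ i‖ ≤ Real.exp (δ / 4 * k) := by
      intro i hi
      rw [norm_pow]
      calc ‖t‖ ^ i ≤ Real.exp (δ / 4) ^ i := by gcongr
        _ ≤ Real.exp (δ / 4) ^ k := by
          apply pow_le_pow_right₀ (Real.one_le_exp (by positivity))
          exact (Finset.mem_range.1 hi).le
        _ = _ := by rw [← Real.exp_nat_mul, mul_comm]
    simpa using Finset.sum_le_sum this
  have hk : (k : ℝ) ≤ 4 / δ * Real.exp (δ / 4 * k) := by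
    have := Real.add_one_le_exp (δ / 4 * k)
    calc (k : ℝ) = 4 / δ * (δ / 4 * k) := by field_simp
      _ ≤ _ := by gcongr; linarith
  have hfrac : ‖t / (1 + t)‖ ≤ 2 * Real.exp (δ / 4) := by
    rw [norm_div, div_le_iff₀ (by linarith)]
    nlinarith [Real.exp_pos (δ / 4)]
  rw [bk, norm_mul, norm_neg]
  have e : Real.exp (δ / 2 * k) = Real.exp (δ / 4 * k) * Real.exp (δ / 4 * k) := by
    rw [← Real.exp_add]; congr 1; ring
  rw [e]
  calc _ ≤ (2 * Real.exp (δ / 4)) * (k * Real.exp (δ / 4 * k)) := by gcongr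
    _ ≤ (2 * Real.exp (δ / 4)) * ((4 / δ * Real.exp (δ / 4 * k)) * Real.exp (δ / 4 * k)) := by gcongr
    _ = _ := by ring

set_option maxHeartbeats 2000000 in
lemma core1 {H F : Type*} [NormedAddCommGroup H] [NormedSpace ℂ H] [CompleteSpace H]
    [NormedAddCommGroup F] [NormedSpace ℂ F] [FiniteDimensional ℂ F]
    (j : F →L[ℂ] H) (T : H →L[ℂ] F) (γ C : ℝ) (hγ : 0 < γ) (hC : 0 < C)
    (w : ℤ × ℤ → H →L[ℂ] H)
    (hw : ∀ n m : ℤ, ‖w (n, m)‖ ≤ C * Real.exp (-γ * (|(n : ℝ)| + |(m : ℝ)|))) :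
    ∀ᶠ t in 𝓝[≠] (1 : ℂ), ∀ ψ : ℤ → H, (∃ B, ∀ n, ‖ψ n‖ ≤ B) → ∀ f : ℤ → F,
      (∀ m, HasSum (fun l => T (w (m, l) (ψ l))) (f m)) →
      (∀ n, HasSum (fun m => t ^ (n - m).natAbs • j (f m)) (-((t⁻¹ - t) • ψ n))) →
      ψ = 0 := by
  have : CompleteSpace F := FiniteDimensional.complete ℂ F
  obtain ⟨δ, hδ0⟩ : ∃ δ, δ = γ / 2 := ⟨_, rfl⟩
  have hδ : 0 < δ := by rw [hδ0]; positivity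
  have hγδ : γ = 2 * δ := by rw [hδ0]; ring
  obtain ⟨ε, hε, hε1, hε2⟩ : ∃ ε : ℝ, 0 < ε ∧ ε ≤ 1 / 2 ∧ 1 + ε ≤ Real.exp (δ / 4) := by
    refine ⟨min (1 / 2) (δ / 4), by positivity, min_le_left _ _, ?_⟩
    have := Real.add_one_le_exp (δ / 4)
    linarith [min_le_right (1 / 2) (δ / 4)]
  let U : Set ℂ := Metric.ball (1 / 2) (1 / 2 + ε)
  have hUo : IsOpen U := Metric.isOpen_ball
  have hUn : ∀ t ∈ U, ‖t‖ ≤ Real.exp (δ / 4) := by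
    intro t ht
    have h1 : ‖t - 1 / 2‖ < 1 / 2 + ε := by simpa [U, dist_eq_norm] using ht
    have h2 : ‖t‖ ≤ ‖t - 1 / 2‖ + ‖(1 / 2 : ℂ)‖ := by
      simpa using norm_add_le (t - 1 / 2) (1 / 2)
    have h3 : ‖(1 / 2 : ℂ)‖ = 1 / 2 := by norm_num
    linarith
  have hUm : ∀ t ∈ U, 1 / 2 ≤ ‖1 + t‖ := by
    intro t ht
    have h1 : ‖t - 1 / 2‖ < 1 / 2 + ε := by simpa [U, dist_eq_norm] using ht
    have h2 : ‖(3 / 2 : ℂ)‖ ≤ ‖1 + t‖ + ‖t - 1 / 2‖ := by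
      have := norm_sub_le (1 + t) (t - 1 / 2)
      rwa [show 1 + t - (t - 1 / 2) = (3 / 2 : ℂ) by ring] at this
    have h3 : ‖(3 / 2 : ℂ)‖ = 3 / 2 := by norm_num
    linarith
  have hUne : ∀ t ∈ U, 1 + t ≠ 0 := by
    intro t ht h
    have := hUm t ht
    rw [h, norm_zero] at this
    linarith
  -- weights
  let ρ : ℤ → ℝ := fun n => Real.exp (-δ * |(n : ℝ)|)
  have hρpos : ∀ n, 0 < ρ n := fun n => Real.exp_pos _
  have hρs : Summable ρ := summable_exp_abs δ hδ
  have hρC : ∀ n, ((ρ n : ℝ) : ℂ) ≠ 0 := fun n => by exact_mod_cast (hρpos n).ne'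
  let B : ℝ := 2 * Real.exp (δ / 4) * (4 / δ)
  have hB : 0 < B := by positivity
  let g : ℤ → ℤ → ℂ → ℂ := fun m n t => (ρ n : ℂ) * bk (n - m).natAbs t
  let ug : ℤ → ℤ → ℝ := fun m n =>
    B * Real.exp (δ / 2 * |(m : ℝ)|) * Real.exp (-(δ / 2) * |(n : ℝ)|)
  have hug : ∀ m, Summable (ug m) := fun m => (summable_exp_abs (δ / 2) (by positivity)).mul_left _
  have hg : ∀ m n, ∀ t ∈ U, ‖g m n t‖ ≤ ug m n := by
    intro m n t ht
    have h1 := bk_bound δ hδ (n - m).natAbs t (hUn t ht) (hUm t ht)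
    have h2 : (((n - m).natAbs : ℕ) : ℝ) ≤ |(n : ℝ)| + |(m : ℝ)| := by
      rw [Nat.cast_natAbs]; push_cast; exact abs_sub _ _
    have h3 : ‖((ρ n : ℝ) : ℂ)‖ = ρ n := by
      rw [Complex.norm_real, Real.norm_of_nonneg (hρpos n).le]
    simp only [g, norm_mul, h3]
    calc ρ n * ‖bk (n - m).natAbs t‖ ≤ ρ n * (B * Real.exp (δ / 2 * (n - m).natAbs)) := by
          gcongr
      _ ≤ ρ n * (B * Real.exp (δ / 2 * (|(n : ℝ)| + |(m : ℝ)|))) := by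
          gcongr
      _ = B * (Real.exp (-δ * |(n : ℝ)|) * Real.exp (δ / 2 * (|(n : ℝ)| + |(m : ℝ)|))) := by
          simp only [ρ]; ring
      _ = ug m n := by
          simp only [ug]
          rw [mul_assoc B, ← Real.exp_add, ← Real.exp_add]
          congr 2; ring
  have hgd : ∀ m n, DifferentiableOn ℂ (g m n) U := by
    intro m n
    apply DifferentiableOn.const_mul
    unfold bk
    apply DifferentiableOn.mul
    · apply DifferentiableOn.neg
      exact differentiableOn_id.div (differentiableOn_id.const_add 1) hUne
    · exact DifferentiableOn.fun_sum fun i _ => differentiableOn_id.pow i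
  let E := lp (fun _ : ℤ => H) ⊤
  -- the maps a_m
  let A : ℤ → ℤ → E →L[ℂ] F := fun m l =>
    (((ρ l)⁻¹ : ℝ) : ℂ) • ((T ∘L w (m, l)) ∘L lp.evalCLM ℂ (fun _ : ℤ => H) (p := ⊤) l)
  let uA : ℤ → ℤ → ℝ := fun m l => (‖T‖ * C * Real.exp (-γ * |(m : ℝ)|)) * ρ l
  have huA : ∀ m, Summable (uA m) := fun m => hρs.mul_left _
  have hA : ∀ m l, ‖A m l‖ ≤ uA m l := by
    intro m l
    have he : ‖lp.evalCLM ℂ (fun _ : ℤ => H) (p := ⊤) l‖ ≤ 1 := by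
      refine ContinuousLinearMap.opNorm_le_bound _ zero_le_one fun x => ?_
      rw [one_mul]
      exact lp.norm_apply_le_norm (by simp) x l
    simp only [A, norm_smul, Complex.norm_real, norm_inv, Real.norm_of_nonneg (hρpos l).le]
    have hn : ‖(T ∘L w (m, l)) ∘L lp.evalCLM ℂ (fun _ : ℤ => H) (p := ⊤) l‖ ≤
        ‖T‖ * (C * Real.exp (-γ * (|(m : ℝ)| + |(l : ℝ)|))) := by
      refine (ContinuousLinearMap.opNorm_comp_le _ _).trans ?_
      calc _ ≤ ‖T ∘L w (m, l)‖ * 1 := by gcongr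
        _ = ‖T ∘L w (m, l)‖ := mul_one _
        _ ≤ ‖T‖ * ‖w (m, l)‖ := ContinuousLinearMap.opNorm_comp_le _ _
        _ ≤ _ := by gcongr; exact hw m l
    calc _ ≤ (ρ l)⁻¹ * (‖T‖ * (C * Real.exp (-γ * (|(m : ℝ)| + |(l : ℝ)|)))) := by
          gcongr
      _ = ‖T‖ * C * ((ρ l)⁻¹ * Real.exp (-γ * (|(m : ℝ)| + |(l : ℝ)|))) := by ring
      _ = _ := by
          simp only [uA, ρ]
          rw [mul_assoc (‖T‖ * C), ← Real.exp_neg, ← Real.exp_add, ← Real.exp_add]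
          congr 2; rw [hγδ]; ring
  let a0 : ℤ → E →L[ℂ] F := fun m => ∑' l, A m l
  have hAs : ∀ m, Summable (A m) := fun m => Summable.of_norm_bounded (huA m) (hA m)
  have ha0 : ∀ m, ‖a0 m‖ ≤ (‖T‖ * C * Real.exp (-γ * |(m : ℝ)|)) * ∑' l, ρ l := fun m =>
    tsum_of_norm_bounded (hρs.hasSum.mul_left _) (hA m)
  -- the family on `E × F`
  let a : Unit ⊕ ℤ → (E × F) →L[ℂ] F := Sum.elim (fun _ => ContinuousLinearMap.snd ℂ E F)
    (fun m => a0 m ∘L ContinuousLinearMap.fst ℂ E F)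
  let J : Unit ⊕ ℤ → ℂ → F →L[ℂ] (E × F) := Sum.elim
    (fun _ t => ContinuousLinearMap.inl ℂ E F ∘L Kop j (fun n => (ρ n : ℂ)) +
      (-t ^ 2) • ContinuousLinearMap.inr ℂ E F)
    (fun m t => ContinuousLinearMap.inl ℂ E F ∘L Kop j (fun n => g m n t) +
      (-t) • ContinuousLinearMap.inr ℂ E F)
  have hρn : ∀ n, ‖((ρ n : ℝ) : ℂ)‖ ≤ ρ n := fun n => by
    rw [Complex.norm_real, Real.norm_of_nonneg (hρpos n).le]
  have hJn : ∀ (K : F →L[ℂ] E) (s : ℂ), ‖ContinuousLinearMap.inl ℂ E F ∘L K +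
      s • ContinuousLinearMap.inr ℂ E F‖ ≤ ‖K‖ + ‖s‖ := by
    intro K s
    refine (norm_add_le _ _).trans (add_le_add ?_ ?_)
    · refine (ContinuousLinearMap.opNorm_comp_le _ _).trans ?_
      exact mul_le_of_le_one_left (norm_nonneg _) (ContinuousLinearMap.norm_inl_le_one ℂ E F)
    · rw [norm_smul]
      exact mul_le_of_le_one_right (norm_nonneg _) (ContinuousLinearMap.norm_inr_le_one ℂ E F)
  have hJd : ∀ i, DifferentiableOn ℂ (J i) U := by
    rintro (_ | m)
    · apply DifferentiableOn.const_add
      apply DifferentiableOn.smul_const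
      exact (differentiableOn_id.pow 2).neg
    · apply DifferentiableOn.add
      · intro t ht
        exact (differentiableWithinAt_const _).clm_comp
          (Kop_diff j U hUo (g m) (ug m) (hug m) (hg m) (hgd m) t ht)
      · apply DifferentiableOn.smul_const
        exact differentiableOn_id.neg
  let Z : ℝ := ∑' n : ℤ, Real.exp (-(δ / 2) * |(n : ℝ)|)
  let Y : ℝ := ∑' n : ℤ, ρ n
  have hZ : 0 ≤ Z := tsum_nonneg fun n => (Real.exp_pos _).le
  have hY : 0 ≤ Y := tsum_nonneg fun n => (hρpos n).le
  let u : Unit ⊕ ℤ → ℝ := Sum.elim (fun _ => Y * ‖j‖ + Real.exp (δ / 4) ^ 2)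
    (fun m => ((B * Z * ‖j‖ + Real.exp (δ / 4)) * (‖T‖ * C * Y)) *
      Real.exp (-(3 * δ / 2) * |(m : ℝ)|))
  have hu : Summable u := by
    have h1 : Summable (u ∘ Sum.inr) := (summable_exp_abs (3 * δ / 2) (by positivity)).mul_left _
    have h2 : Summable (u ∘ Sum.inl) := Summable.of_finite
    exact (h2.hasSum.sum h1.hasSum).summable
  have hb : ∀ i, ∀ t ∈ U, ‖J i t‖ * ‖a i‖ ≤ u i := by
    rintro (_ | m) t ht
    · have h1 : ‖a (Sum.inl ())‖ ≤ 1 := ContinuousLinearMap.norm_snd_le ℂ E F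
      have h2 : ‖J (Sum.inl ()) t‖ ≤ Y * ‖j‖ + Real.exp (δ / 4) ^ 2 := by
        refine (hJn _ _).trans (add_le_add (Kop_norm j _ ρ hρs hρn) ?_)
        rw [norm_neg, norm_pow]
        have := hUn t ht
        gcongr
      calc _ ≤ ‖J (Sum.inl ()) t‖ * 1 := by gcongr
        _ ≤ _ := by rw [mul_one]; exact h2
    · have h1 : ‖a (Sum.inr m)‖ ≤ (‖T‖ * C * Y) * Real.exp (-γ * |(m : ℝ)|) := by
        refine (ContinuousLinearMap.opNorm_comp_le _ _).trans ?_
        refine (mul_le_of_le_one_right (norm_nonneg _) (ContinuousLinearMap.norm_fst_le ℂ E F)).trans ?_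
        refine (ha0 m).trans (le_of_eq ?_)
        simp only [Y]; ring
      have h2 : ‖J (Sum.inr m) t‖ ≤
          (B * Z * ‖j‖ + Real.exp (δ / 4)) * Real.exp (δ / 2 * |(m : ℝ)|) := by
        have h3 := Kop_norm j (fun n => g m n t) (ug m) (hug m) (fun n => hg m n t ht)
        have h4 : ∑' n, ug m n = B * Real.exp (δ / 2 * |(m : ℝ)|) * Z := tsum_mul_left
        rw [h4] at h3
        have h5 : 1 ≤ Real.exp (δ / 2 * |(m : ℝ)|) := Real.one_le_exp (by positivity)
        have h6 := hUn t ht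
        have h7 := hJn (Kop j (fun n => g m n t)) (-t)
        rw [norm_neg] at h7
        refine h7.trans ?_
        have h8 : Real.exp (δ / 4) ≤ Real.exp (δ / 4) * Real.exp (δ / 2 * |(m : ℝ)|) :=
          le_mul_of_one_le_right (Real.exp_pos _).le h5
        linarith
      have h9 : Real.exp (-(3 * δ / 2) * |(m : ℝ)|) =
          Real.exp (δ / 2 * |(m : ℝ)|) * Real.exp (-γ * |(m : ℝ)|) := by
        rw [← Real.exp_add]; congr 1; rw [hγδ]; ring
      calc _ ≤ ((B * Z * ‖j‖ + Real.exp (δ / 4)) * Real.exp (δ / 2 * |(m : ℝ)|)) *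
            ((‖T‖ * C * Y) * Real.exp (-γ * |(m : ℝ)|)) := by gcongr
        _ = _ := by simp only [u, Sum.elim_inr]; rw [h9]; ring
  have h0U : (0 : ℂ) ∈ U := by
    simp only [U, Metric.mem_ball, dist_eq_norm]
    norm_num; linarith
  have h1U : (1 : ℂ) ∈ U := by
    simp only [U, Metric.mem_ball, dist_eq_norm]
    norm_num; linarith
  have hinj0 : ∀ y : E × F, y + ∑' i, J i 0 (a i y) = 0 → y = 0 := by
    rintro ⟨x, c⟩ hy
    have hz : ∀ i, i ≠ Sum.inl () → J i 0 (a i (x, c)) = 0 := by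
      rintro (_ | m) hi
      · exact absurd rfl hi
      · simp [J, g, bk, Kop]
    rw [tsum_eq_single _ hz] at hy
    have hc : c = 0 := by simpa [J, a] using congrArg Prod.snd hy
    subst hc
    have hx : x = 0 := by simpa [J, a] using congrArg Prod.fst hy
    rw [hx]; rfl
  have key := fredholm_like U hUo (convex_ball _ _).isPreconnected a J hJd u hu hb 0 h0U hinj0 1 h1U
  have hne0 : ∀ᶠ t in 𝓝[≠] (1 : ℂ), t ≠ 0 :=
    nhdsWithin_le_nhds (isOpen_ne.mem_nhds one_ne_zero)
  filter_upwards [key, nhdsWithin_le_nhds (hUo.mem_nhds h1U), hne0, self_mem_nhdsWithin]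
    with t hinj htU ht0 ht1 ψ hψ f hf hR
  have ht1' : 1 - t ≠ 0 := fun h => ht1 (sub_eq_zero.1 h).symm
  have ht2 : 1 + t ≠ 0 := hUne t htU
  have hd : t⁻¹ - t ≠ 0 := by
    have : t⁻¹ - t = t⁻¹ * ((1 - t) * (1 + t)) := by field_simp; ring
    rw [this]
    exact mul_ne_zero (inv_ne_zero ht0) (mul_ne_zero ht1' ht2)
  obtain ⟨M, hM⟩ := hψ
  have hM0 : 0 ≤ M := (norm_nonneg _).trans (hM 0)
  have hxm : Memℓp (fun n : ℤ => (ρ n : ℂ) • ψ n) ⊤ := by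
    apply memℓp_infty
    refine ⟨M, ?_⟩
    rintro _ ⟨n, rfl⟩
    simp only [norm_smul]
    have h1 : ρ n ≤ 1 := by
      apply Real.exp_le_one_iff.2
      have := abs_nonneg (n : ℝ)
      nlinarith
    calc _ ≤ 1 * M := mul_le_mul ((hρn n).trans h1) (hM n) (norm_nonneg _) zero_le_one
      _ = M := one_mul M
  let x : E := ⟨_, hxm⟩
  have hxn : ∀ n, x n = (ρ n : ℂ) • ψ n := fun n => rfl
  have hax : ∀ m, a0 m x = f m := by
    intro m
    have h1 := (hAs m).hasSum.mapL (ContinuousLinearMap.apply ℂ F x)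
    refine h1.unique ?_
    convert hf m using 1
    funext l
    change (((ρ l)⁻¹ : ℝ) : ℂ) • T (w (m, l) (x l)) = _
    rw [hxn, map_smul, map_smul, smul_smul, Complex.ofReal_inv, inv_mul_cancel₀ (hρC l), one_smul]
  have hfs : Summable f := by
    refine Summable.of_norm_bounded (g := fun m : ℤ => Real.exp (-γ * |(m : ℝ)|) *
      (‖T‖ * C * Y * ‖x‖)) ((summable_exp_abs γ hγ).mul_right _) fun m => ?_
    rw [← hax]
    refine ((a0 m).le_opNorm x).trans ?_
    calc _ ≤ ((‖T‖ * C * Real.exp (-γ * |(m : ℝ)|)) * ∑' l, ρ l) * ‖x‖ := by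
          gcongr; exact ha0 m
      _ = _ := by simp only [Y]; ring
  obtain ⟨s, hs⟩ := hfs
  let c : F := (t⁻¹ - t)⁻¹ • s
  have hJs : Summable fun m : ℤ => J (Sum.inr m) t (f m) := by
    have h1 : Summable fun m : ℤ => J (Sum.inr m) t ∘L a (Sum.inr m) :=
      Summable.of_norm_bounded (hu.comp_injective Sum.inr_injective)
        (fun m => (ContinuousLinearMap.opNorm_comp_le _ _).trans (hb _ t htU))
    have h2 := (h1.hasSum.mapL (ContinuousLinearMap.apply ℂ (E × F) ((x, c) : E × F))).summable
    refine h2.congr fun m => ?_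
    change J (Sum.inr m) t (a0 m x) = _
    rw [hax]
  obtain ⟨y, hy⟩ := hJs
  have hy2 : y.2 = (-t) • s := by
    refine (hy.mapL (ContinuousLinearMap.snd ℂ E F)).unique ?_
    convert hs.const_smul (-t) using 1
    funext m
    simp [J]
  have hy1 : ∀ n, y.1 n = -((ρ n : ℂ) • ψ n) - (ρ n : ℂ) • j c := by
    intro n
    refine (hy.mapL (lp.evalCLM ℂ (fun _ : ℤ => H) (p := ⊤) n ∘L
      ContinuousLinearMap.fst ℂ E F)).unique ?_
    have h1 := (((hR n).sub (hs.mapL j)).const_smul (t⁻¹ - t)⁻¹).const_smul (ρ n : ℂ)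
    convert h1 using 1
    · funext m
      have h2 : (lp.evalCLM ℂ (fun _ : ℤ => H) (p := ⊤) n ∘L ContinuousLinearMap.fst ℂ E F)
          (J (Sum.inr m) t (f m)) = (Kop j (fun n => g m n t) (f m)) n := by
        simp [J, lp.evalCLM]
      rw [h2, Kop_apply j _ (ug m) (hug m) (fun n => hg m n t htU)]
      have h3 := (bk_eq (n - m).natAbs t ht1' ht2).resolve_right ht0
      have h4 : bk (n - m).natAbs t = (t⁻¹ - t)⁻¹ * (t ^ (n - m).natAbs - 1) := by
        rw [← h3, inv_mul_cancel_left₀ hd]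
      simp only [g]
      rw [h4, mul_smul, mul_smul, sub_smul, one_smul]
    · simp only [c, map_smul]
      rw [smul_sub, smul_sub, smul_neg, smul_smul (t⁻¹ - t)⁻¹, inv_mul_cancel₀ hd, one_smul, smul_neg]
  have htot : HasSum (fun i => J i t (a i ((x, c) : E × F))) (-((x, c) : E × F)) := by
    have hl : HasSum ((fun i => J i t (a i ((x, c) : E × F))) ∘ Sum.inl)
        (J (Sum.inl ()) t c) := by
      have := hasSum_unique ((fun i => J i t (a i ((x, c) : E × F))) ∘ Sum.inl)
      exact this
    have hr : HasSum ((fun i => J i t (a i ((x, c) : E × F))) ∘ Sum.inr) y := by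
      convert hy using 1
      funext m
      change J (Sum.inr m) t (a0 m x) = _
      rw [hax]
    convert hl.sum hr using 1
    apply Prod.ext
    · apply lp.ext
      funext n
      have h1 : (J (Sum.inl ()) t c).1 = Kop j (fun n => (ρ n : ℂ)) c := by simp [J]
      rw [Prod.fst_add, h1, Prod.fst_neg, lp.coeFn_neg, lp.coeFn_add, Pi.neg_apply, Pi.add_apply,
        hy1, Kop_apply j _ ρ hρs hρn, hxn]
      abel
    · have h1 : (J (Sum.inl ()) t c).2 = (-t ^ 2) • c := by simp [J]
      rw [Prod.snd_add, h1, hy2, Prod.snd_neg]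
      have h2 : s = (t⁻¹ - t) • c := by simp only [c]; rw [smul_smul, mul_inv_cancel₀ hd, one_smul]
      change -c = _
      rw [h2, smul_smul (-t), ← add_smul]
      have h3 : -t ^ 2 + -t * (t⁻¹ - t) = -1 := by field_simp; ring
      rw [h3, neg_smul, one_smul]
  have hzero := hinj (x, c) (by rw [htot.tsum_eq, add_neg_cancel])
  have hx0 : x = 0 := congrArg Prod.fst hzero
  funext n
  have h1 := hxn n
  rw [hx0] at h1
  have h2 : (ρ n : ℂ) • ψ n = 0 := h1.symm
  exact (smul_eq_zero.1 h2).resolve_left (hρC n)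

lemma exists_root (z : ℂ) : ∃ t : ℂ, t ≠ 0 ∧ ‖t‖ ≤ 1 ∧ t + t⁻¹ = 2 - z := by
  obtain ⟨s, hs⟩ := IsAlgClosed.exists_pow_nat_eq ((2 - z) ^ 2 - 4) (n := 2) two_pos
  have hprod : ((2 - z + s) / 2) * ((2 - z - s) / 2) = 1 := by
    linear_combination -hs / 4
  have gen : ∀ a b : ℂ, a * b = 1 → a + b = 2 - z → ‖a‖ ≤ 1 →
      ∃ t : ℂ, t ≠ 0 ∧ ‖t‖ ≤ 1 ∧ t + t⁻¹ = 2 - z := by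
    intro a b hab hsum ha
    refine ⟨a, left_ne_zero_of_mul_eq_one hab, ha, ?_⟩
    rw [inv_eq_of_mul_eq_one_right hab, hsum]
  by_cases h : ‖(2 - z + s) / 2‖ ≤ 1
  · exact gen _ _ hprod (by ring) h
  · refine gen ((2 - z - s) / 2) ((2 - z + s) / 2) (by rw [mul_comm]; exact hprod) (by ring) ?_
    have h1 := congrArg norm hprod
    rw [norm_mul, norm_one] at h1
    have h2 := norm_nonneg ((2 - z - s) / 2)
    push Not at h
    nlinarith

lemma core2 {H : Type*} [NormedAddCommGroup H] [NormedSpace ℂ H] [CompleteSpace H]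
    (γ C : ℝ) (hγ : 0 < γ) (hC : 0 < C)
    (w : ℤ × ℤ → H →L[ℂ] H)
    (hw : ∀ n m : ℤ, ‖w (n, m)‖ ≤ C * Real.exp (-γ * (|(n : ℝ)| + |(m : ℝ)|)))
    (Λ₁ Λ₂ : H →L[ℂ] H)
    (hfin : FiniteDimensional ℂ (LinearMap.range (Λ₂ ∘L Λ₁ : H →L[ℂ] H).toLinearMap)) :
    ∃ r : ℝ, 0 < r ∧ ∀ z : ℂ, 0 < ‖z‖ → ‖z‖ < r → ∀ φ : ℤ → H,
      Tendsto φ cofinite (𝓝 0) → (∃ B, ∀ n, ‖φ n‖ ≤ B) →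
      (∀ n, HasSum (fun m : ℤ => Λ₁ (w (n, m) (Λ₂ (φ m))))
        (z • φ n - ((2 : ℂ) • φ n - φ (n + 1) - φ (n - 1)))) → φ = 0 := by
  let F := LinearMap.range (Λ₂ ∘L Λ₁ : H →L[ℂ] H).toLinearMap
  let j : F →L[ℂ] H := F.subtypeL
  let T : H →L[ℂ] F := (Λ₂ ∘L Λ₁).codRestrict F (fun x => LinearMap.mem_range_self _ x)
  have hjT : ∀ x, j (T x) = Λ₂ (Λ₁ x) := fun x => rfl
  have hev := core1 j T γ C hγ hC w hw
  rw [eventually_nhdsWithin_iff, Metric.eventually_nhds_iff] at hev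
  obtain ⟨ε, hε, hev⟩ := hev
  refine ⟨(min ε 1) ^ 2, by positivity, fun z hz0 hzr φ hφ hφB hV => ?_⟩
  obtain ⟨t, ht0, htn, htz⟩ := exists_root z
  have hsq : (t - 1) ^ 2 = -z * t := by
    have : t * (t + t⁻¹) = t * (2 - z) := by rw [htz]
    rw [mul_add, mul_inv_cancel₀ ht0] at this
    linear_combination this
  have htd : ‖t - 1‖ < min ε 1 := by
    apply lt_of_pow_lt_pow_left₀ 2 (by positivity)
    rw [← norm_pow, hsq, norm_mul, norm_neg]
    exact (mul_le_of_le_one_right (norm_nonneg _) htn).trans_lt hzr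
  have ht1 : t ≠ 1 := by
    rintro rfl
    simp at hsq
    simp [hsq] at hz0
  have ht2 : t ≠ -1 := by
    rintro rfl
    have := htd.trans_le (min_le_right _ _)
    norm_num at this
  have hd : t⁻¹ - t ≠ 0 := by
    have : t⁻¹ - t = t⁻¹ * ((1 - t) * (1 + t)) := by field_simp; ring
    rw [this]
    refine mul_ne_zero (inv_ne_zero ht0) (mul_ne_zero (sub_ne_zero.2 ht1.symm) ?_)
    intro h
    exact ht2 (eq_neg_of_add_eq_zero_right h)
  obtain ⟨M, hM⟩ := hφB
  have hM0 : 0 ≤ M := (norm_nonneg _).trans (hM 0)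
  have hS := summable_exp_abs γ hγ
  have hwb : ∀ n m, ‖w (n, m) (Λ₂ (φ m))‖ ≤
      (C * Real.exp (-γ * |(n : ℝ)|) * (‖Λ₂‖ * M)) * Real.exp (-γ * |(m : ℝ)|) := by
    intro n m
    calc _ ≤ ‖w (n, m)‖ * ‖Λ₂ (φ m)‖ := ContinuousLinearMap.le_opNorm _ _
      _ ≤ (C * Real.exp (-γ * (|(n : ℝ)| + |(m : ℝ)|))) * (‖Λ₂‖ * M) := by
          gcongr
          · exact hw n m
          · exact (Λ₂.le_opNorm _).trans (by gcongr; exact hM m)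
      _ = _ := by rw [mul_add, Real.exp_add]; ring
  have hws : ∀ n, Summable fun m => w (n, m) (Λ₂ (φ m)) := fun n =>
    Summable.of_norm_bounded (hS.mul_left _) (hwb n)
  let h : ℤ → H := fun m => (t + t⁻¹) • φ m - φ (m + 1) - φ (m - 1)
  have hVh : ∀ n, HasSum (fun m : ℤ => Λ₁ (w (n, m) (Λ₂ (φ m)))) (-h n) := by
    intro n
    convert hV n using 1
    simp only [h, htz, sub_smul]
    abel
  have hh : ∀ n, -h n = Λ₁ (∑' m, w (n, m) (Λ₂ (φ m))) := fun n =>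
    (hVh n).unique ((hws n).hasSum.mapL Λ₁)
  have hhs : Summable fun n => ‖h n‖ := by
    refine Summable.of_nonneg_of_le (fun _ => norm_nonneg _) (fun n => ?_)
      (hS.mul_right (‖Λ₁‖ * (C * (‖Λ₂‖ * M) * ∑' m : ℤ, Real.exp (-γ * |(m : ℝ)|))))
    rw [← norm_neg, hh]
    have h1 := tsum_of_norm_bounded (hS.hasSum.mul_left _) (hwb n)
    calc _ ≤ ‖Λ₁‖ * ‖∑' m, w (n, m) (Λ₂ (φ m))‖ := Λ₁.le_opNorm _
      _ ≤ ‖Λ₁‖ * ((C * Real.exp (-γ * |(n : ℝ)|) * (‖Λ₂‖ * M)) *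
          ∑' m : ℤ, Real.exp (-γ * |(m : ℝ)|)) := by gcongr
      _ = _ := by ring
  have hgreen := green t ht0 htn φ hφ h (fun _ => rfl) hhs
  have hψ : (fun n => Λ₂ (φ n)) = 0 := by
    refine hev (by rw [dist_eq_norm]; exact htd.trans_le (min_le_left _ _)) ht1 _
      ⟨‖Λ₂‖ * M, fun n => (Λ₂.le_opNorm _).trans (by gcongr; exact hM n)⟩
      (fun m => T (∑' l, w (m, l) (Λ₂ (φ l)))) (fun m => (hws m).hasSum.mapL T) (fun n => ?_)
    have h1 := ((hgreen n).mapL Λ₂).neg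
    convert h1 using 1
    · funext m
      rw [hjT, ← hh]
      simp
    · simp
  have hz : ∀ n, h n = 0 := by
    intro n
    have h1 := hh n
    have h2 : ∀ m, Λ₂ (φ m) = 0 := fun m => congrFun hψ m
    simp only [h2, map_zero, tsum_zero] at h1
    exact neg_eq_zero.1 h1
  funext n
  have h1 := hgreen n
  simp only [hz, smul_zero] at h1
  exact (smul_eq_zero.1 (h1.unique hasSum_zero)).resolve_left hd



/-- (Theorem 2.3/`t1s` of the paper, consequence for eigenvalues.) With
the data of Statement 17, `H_V = H₀ + V` has no eigenvalues in punctured disks around the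
spectral thresholds `0` and `4`. -/
theorem no_eigenvalues_near_thresholds
    (H : Type*) [NormedAddCommGroup H] [InnerProductSpace ℂ H] [CompleteSpace H]
    [Nontrivial H] [TopologicalSpace.SeparableSpace H]
    (γ C : ℝ) (hγ : 0 < γ) (hC : 0 < C)
    (w : ℤ × ℤ → H →L[ℂ] H)
    (hw : ∀ n m : ℤ, ‖w (n, m)‖ ≤ C * Real.exp (-γ * (|(n : ℝ)| + |(m : ℝ)|)))
    (Λ₁ Λ₂ : H →L[ℂ] H) (hΛ₂ : IsCompactOperator Λ₂)
    (hfin : FiniteDimensional ℂ (LinearMap.range (Λ₂ ∘L Λ₁ : H →L[ℂ] H).toLinearMap))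
    (H0 V : lp (fun _ : ℤ => H) 2 →L[ℂ] lp (fun _ : ℤ => H) 2)
    (hH0 : ∀ (φ : lp (fun _ : ℤ => H) 2) (n : ℤ),
      (H0 φ) n = (2 : ℂ) • φ n - φ (n + 1) - φ (n - 1))
    (hV : ∀ (φ : lp (fun _ : ℤ => H) 2) (n : ℤ),
      HasSum (fun m : ℤ => Λ₁ (w (n, m) (Λ₂ (φ m)))) ((V φ) n)) :
    ∃ r : ℝ, 0 < r ∧ ∀ z : ℂ,
      ((0 < ‖z‖ ∧ ‖z‖ < r) ∨
       (0 < ‖z - 4‖ ∧ ‖z - 4‖ < r)) →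
      ∀ φ : lp (fun _ : ℤ => H) 2, (H0 + V) φ = z • φ → φ = 0 := by
  have htend : ∀ φ : lp (fun _ : ℤ => H) 2, Tendsto (fun n => φ n) cofinite (𝓝 0) := by
    intro φ
    have h1 : Summable fun n => ‖φ n‖ ^ (2 : ℝ) := by
      simpa using (lp.memℓp φ).summable (by norm_num)
    have h2 := h1.tendsto_cofinite_zero
    rw [tendsto_zero_iff_norm_tendsto_zero]
    have h3 := (Real.continuous_sqrt.tendsto 0).comp h2
    rw [Real.sqrt_zero] at h3
    refine h3.congr fun n => ?_
    simp [Real.sqrt_sq (norm_nonneg _)]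
  have hbdd : ∀ φ : lp (fun _ : ℤ => H) 2, ∀ n, ‖φ n‖ ≤ ‖φ‖ := fun φ n =>
    lp.norm_apply_le_norm (by norm_num) φ n
  have hVφ : ∀ (z : ℂ) (φ : lp (fun _ : ℤ => H) 2), (H0 + V) φ = z • φ → ∀ n,
      HasSum (fun m : ℤ => Λ₁ (w (n, m) (Λ₂ (φ m))))
        (z • φ n - ((2 : ℂ) • φ n - φ (n + 1) - φ (n - 1))) := by
    intro z φ h n
    convert hV φ n using 1
    have h1 : ((H0 φ) n : H) + (V φ) n = z • φ n :=
      congrArg (fun x : lp (fun _ : ℤ => H) 2 => (x n : H)) h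
    rw [← h1, hH0]
    abel
  obtain ⟨r₁, hr₁, H₁⟩ := core2 γ C hγ hC w hw Λ₁ Λ₂ hfin
  let σ : ℤ → ℂ := fun n => (-1) ^ n
  have hσn : ∀ n, ‖σ n‖ = 1 := fun n => by simp [σ]
  have hσs : ∀ n, σ n * σ n = 1 := fun n => by
    simp only [σ]; rw [← mul_zpow]; simp
  have hσp : ∀ n, σ (n + 1) = -σ n := fun n => by
    simp only [σ]; rw [zpow_add₀ (by norm_num)]; simp
  have hσm : ∀ n, σ (n - 1) = -σ n := fun n => by
    have := hσp (n - 1)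
    rw [sub_add_cancel] at this
    rw [this, neg_neg]
  obtain ⟨r₂, hr₂, H₂⟩ := core2 γ C hγ hC (fun p => (-(σ p.1 * σ p.2)) • w p)
    (fun n m => by
      rw [norm_smul, norm_neg, norm_mul, hσn, hσn, one_mul, one_mul]; exact hw n m) Λ₁ Λ₂ hfin
  refine ⟨min r₁ r₂, lt_min hr₁ hr₂, ?_⟩
  rintro z (⟨hz0, hzr⟩ | ⟨hz0, hzr⟩) φ hφ
  · have := H₁ z hz0 (hzr.trans_le (min_le_left _ _)) (fun n => φ n) (htend φ)
      ⟨_, hbdd φ⟩ (hVφ z φ hφ)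
    exact lp.ext this
  · have := H₂ (4 - z) (by rwa [norm_sub_rev]) (by
      rw [norm_sub_rev]; exact hzr.trans_le (min_le_right _ _)) (fun n => σ n • φ n) (by
        have := htend φ
        rw [tendsto_zero_iff_norm_tendsto_zero] at this ⊢
        simpa only [norm_smul, hσn, one_mul] using this)
      ⟨‖φ‖, fun n => by rw [norm_smul, hσn, one_mul]; exact hbdd φ n⟩ (fun n => by
        convert (hVφ z φ hφ n).const_smul (-σ n) using 1
        · funext m
          simp only [map_smul, smul_apply, smul_smul]
          congr 1
          linear_combination -σ n * hσs m
        · rw [hσp, hσm]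
          module)
    apply lp.ext
    funext n
    have h1 : σ n • φ n = 0 := congrFun this n
    have h2 : σ n ≠ 0 := left_ne_zero_of_mul_eq_one (hσs n)
    exact (smul_eq_zero.1 h1).resolve_left h2
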